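/- arXiv:0811.1545 — 6 statements merged into one kernel-verified Lean document; each statement's English description precedes it below -/
import Mathlib

section
/- Let d be a prime. The cycle type of the permutation σ_CNOT1 of (ZMod d) × (ZMod d) defined by (m, n) ↦ (m, n + m) is the multiset consisting of the value d repeated d − 1 times; that is, σ_CNOT1 fixes exactly d basis states and permutes the remaining d² − d states in d − 1 cycles of length d. -/
/-- The CNOT1 gate on a pair of qudits: the permutation of basis labels
sending `(m, n)` to `(m, n + m)`, addition modulo `d`. -/
def cnot1 (d : ℕ) : Equiv.Perm (ZMod d × ZMod d) where
  toFun p := (p.1, p.2 + p.1)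
  invFun p := (p.1, p.2 - p.1)
  left_inv p := by simp
  right_inv p := by simp

theorem cnot1_pow_apply (d k : ℕ) (p : ZMod d × ZMod d) :
    (cnot1 d ^ k) p = (p.1, p.2 + k * p.1) := by
  induction k with
  | zero => simp
  | succ k ih =>
    rw [pow_succ', Equiv.Perm.mul_apply, ih]
    ext
    · rfl
    · simp only [cnot1, Equiv.coe_fn_mk]
      push_cast
      ring

theorem cnot1_pow_self (d : ℕ) : cnot1 d ^ d = 1 := by
  ext p <;> simp [cnot1_pow_apply]

theorem support_cnot1 (d : ℕ) [NeZero d] :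
    (cnot1 d).support = (Finset.univ.erase 0) ×ˢ Finset.univ := by
  ext p
  simp [cnot1, Prod.ext_iff]

theorem card_support_cnot1 (d : ℕ) [NeZero d] :
    (cnot1 d).support.card = (d - 1) * d := by
  simp [support_cnot1, Finset.card_product, Finset.card_erase_of_mem, ZMod.card]

theorem cycleType_cnot1 (d : ℕ) [Fact d.Prime] :
    (cnot1 d).cycleType = Multiset.replicate (d - 1) d := by
  have hd : 0 < d := (Fact.out : d.Prime).pos
  have h := Equiv.Perm.cycleType_of_pow_prime_eq_one (cnot1_pow_self d)
  have hsum := (cnot1 d).sum_cycleType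
  rw [h, Multiset.sum_replicate, smul_eq_mul, card_support_cnot1] at hsum
  rw [h, Nat.eq_of_mul_eq_mul_right hd hsum]
end

section
/- Let d be a prime. The cycle type of the permutation σ_CNOT2 of (ZMod d) × (ZMod d) defined by (m, n) ↦ (m + n, n) is the multiset consisting of the value d repeated d − 1 times; that is, σ_CNOT2 fixes exactly d basis states and permutes the remaining d² − d states in d − 1 cycles of length d. -/
/-- The CNOT2 gate on a pair of qudits: the permutation of basis labels
sending `(m, n)` to `(m + n, n)`, addition modulo `d`. -/
def cnot2 (d : ℕ) : Equiv.Perm (ZMod d × ZMod d) where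
  toFun p := (p.1 + p.2, p.2)
  invFun p := (p.1 - p.2, p.2)
  left_inv p := by simp
  right_inv p := by simp

theorem cnot2_apply (d : ℕ) (p : ZMod d × ZMod d) : cnot2 d p = (p.1 + p.2, p.2) := rfl

theorem cnot2_pow_apply (d k : ℕ) (p : ZMod d × ZMod d) :
    (cnot2 d ^ k) p = (p.1 + k * p.2, p.2) := by
  induction k with
  | zero => simp
  | succ k ih =>
    rw [pow_succ', Equiv.Perm.mul_apply, ih, cnot2_apply]
    ext <;> push_cast <;> ring

theorem cnot2_pow_self (d : ℕ) : cnot2 d ^ d = 1 := by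
  ext p <;> simp [cnot2_pow_apply]

theorem support_cnot2 (d : ℕ) [NeZero d] :
    (cnot2 d).support = Finset.univ ×ˢ {0}ᶜ := by
  ext p
  simp [cnot2_apply, Prod.ext_iff]

theorem card_support_cnot2 (d : ℕ) [NeZero d] : (cnot2 d).support.card = d * (d - 1) := by
  simp [support_cnot2, Finset.card_product, Finset.card_compl, ZMod.card]

theorem cycleType_cnot2 (d : ℕ) [Fact d.Prime] :
    (cnot2 d).cycleType = Multiset.replicate (d - 1) d := by
  have h := Equiv.Perm.cycleType_of_pow_prime_eq_one (cnot2_pow_self d)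
  have hsum := (cnot2 d).sum_cycleType
  rw [h, Multiset.sum_replicate, card_support_cnot2, smul_eq_mul, mul_comm] at hsum
  rw [h, Nat.eq_of_mul_eq_mul_left (Fact.out : d.Prime).pos hsum]
end

section
/- Let d be an odd natural number. Then both the permutation σ_CNOT1 of (ZMod d) × (ZMod d) defined by (m, n) ↦ (m, n + m) and the permutation σ_CNOT2 defined by (m, n) ↦ (m + n, n) are even, i.e. each has sign +1. -/
theorem Equiv.Perm.sign_eq_one_of_pow_eq_one_of_odd {α : Type*} [DecidableEq α] [Fintype α]
    {σ : Equiv.Perm α} {n : ℕ} (hn : Odd n) (h : σ ^ n = 1) : Equiv.Perm.sign σ = 1 := by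
  rw [← pow_one (Equiv.Perm.sign σ), ← Nat.odd_iff.mp hn, ← Int.units_pow_eq_pow_mod_two,
    ← map_pow, h, map_one]

theorem sign_cnot_odd (d : ℕ) (hd : Odd d) :
    letI : NeZero d := ⟨hd.pos.ne'⟩
    Equiv.Perm.sign (cnot1 d) = 1 ∧ Equiv.Perm.sign (cnot2 d) = 1 := by
  let _ : NeZero d := ⟨hd.pos.ne'⟩
  exact ⟨Equiv.Perm.sign_eq_one_of_pow_eq_one_of_odd hd (cnot1_pow_self d),
    Equiv.Perm.sign_eq_one_of_pow_eq_one_of_odd hd (cnot2_pow_self d)⟩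
end

section
/- Let d be a natural number with d ≡ 3 (mod 4). Then the SWAP permutation of (ZMod d) × (ZMod d), sending (m, n) to (n, m), does not lie in the subgroup of the symmetric group on (ZMod d) × (ZMod d) generated by the two permutations σ_CNOT1 : (m, n) ↦ (m, n + m) and σ_CNOT2 : (m, n) ↦ (m + n, n). In other words, no quantum circuit on two qudits composed entirely of CNOT gates implements the SWAP of a pair of qudits when d ≡ 3 (mod 4). -/
/-- The permutations of `R × R` preserving the determinant form
`(p, q) ↦ p.1 * q.2 - p.2 * q.1`. -/
def detPreserving (R : Type*) [CommRing R] : Subgroup (Equiv.Perm (R × R)) where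
  carrier := {g | ∀ p q, (g p).1 * (g q).2 - (g p).2 * (g q).1 = p.1 * q.2 - p.2 * q.1}
  one_mem' _ _ := rfl
  mul_mem' {g h} hg hh p q := (hg (h p) (h q)).trans (hh p q)
  inv_mem' {g} hg p q := by simpa using (hg (g⁻¹ p) (g⁻¹ q)).symm

theorem closure_cnot_le_detPreserving (d : ℕ) :
    Subgroup.closure {cnot1 d, cnot2 d} ≤ detPreserving (ZMod d) := by
  rw [Subgroup.closure_le]
  rintro g (rfl | rfl) p q
  · change p.1 * (q.2 + q.1) - (p.2 + p.1) * q.1 = _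
    ring
  · change (p.1 + p.2) * q.2 - p.2 * (q.1 + q.2) = _
    ring

theorem swap_not_in_closure_cnot (d : ℕ) (hd : d % 4 = 3) :
    (Equiv.prodComm (ZMod d) (ZMod d) : Equiv.Perm (ZMod d × ZMod d)) ∉
      Subgroup.closure {cnot1 d, cnot2 d} := by
  intro hmem
  have hdet := closure_cnot_le_detPreserving d hmem (1, 0) (0, 1)
  have htwo : ((2 : ℕ) : ZMod d) = 0 := by
    simp only [Equiv.prodComm_apply, Prod.swap_prod_mk] at hdet
    push_cast
    linear_combination -hdet
  have hle := Nat.le_of_dvd two_pos ((ZMod.natCast_eq_zero_iff 2 d).mp htwo)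
  omega
end

section
/- Let d be a prime with d ≥ 2. Consider the permutation of ((ZMod d) × (ZMod d)) × Fin (d^(d−2)) given by applying σ_CNOT1 : (m, n) ↦ (m, n + m) to the first factor and the identity to the second factor (i.e. the product permutation σ_CNOT1 × id, representing a CNOT gate acting on two designated qudits inside a register of d qudits). The sign of this permutation equals (−1)^((d−1)·d^(d−2)); in particular it equals −1 if and only if d = 2. -/
theorem sign_prodCongr_refl {α β : Type*} [Fintype α] [DecidableEq α] [Fintype β] [DecidableEq β]
    (σ : Equiv.Perm α) :
    Equiv.Perm.sign (Equiv.prodCongr σ (Equiv.refl β) : Equiv.Perm (α × β)) =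
      Equiv.Perm.sign σ ^ Fintype.card β := by
  have h : (Equiv.prodCongr σ (Equiv.refl β) : Equiv.Perm (α × β)) =
      Equiv.prodCongrLeft fun _ => σ := rfl
  rw [h, Equiv.Perm.sign_prodCongrLeft, Finset.prod_const, Finset.card_univ]

theorem sign_cnot1_of_odd {d : ℕ} [NeZero d] (hd : Odd d) :
    Equiv.Perm.sign (cnot1 d) = 1 := by
  have h : Equiv.Perm.sign (cnot1 d) ^ d = 1 := by
    rw [← map_pow, cnot1_pow_self, map_one]
  rcases Int.units_eq_one_or (Equiv.Perm.sign (cnot1 d)) with h1 | h1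
  · exact h1
  · rw [h1, hd.neg_one_pow] at h
    exact absurd h (by decide)

theorem sign_cnot1_two : Equiv.Perm.sign (cnot1 2) = -1 := by
  decide

/-- A CNOT gate acting on two designated qudits inside a register of `d` qudits:
`σ_CNOT1` on the first factor and the identity on the remaining `d^(d-2)`-dimensional factor. -/
theorem sign_cnot1_prod_id (d : ℕ) [Fact d.Prime] (hd : 2 ≤ d) :
    Equiv.Perm.sign
        (Equiv.prodCongr (cnot1 d) (Equiv.refl (Fin (d ^ (d - 2)))) :
          Equiv.Perm ((ZMod d × ZMod d) × Fin (d ^ (d - 2)))) =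
      (-1) ^ ((d - 1) * d ^ (d - 2)) ∧
    (Equiv.Perm.sign
        (Equiv.prodCongr (cnot1 d) (Equiv.refl (Fin (d ^ (d - 2)))) :
          Equiv.Perm ((ZMod d × ZMod d) × Fin (d ^ (d - 2)))) = -1 ↔ d = 2) := by
  rw [sign_prodCongr_refl, Fintype.card_fin]
  rcases (Fact.out : d.Prime).eq_two_or_odd' with rfl | hodd
  · have h : Equiv.Perm.sign (cnot1 2) = -1 := by
      convert sign_cnot1_two
    simp [h]
  · have hne : d ≠ 2 := by
      rintro rfl
      exact absurd hodd (by decide)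
    have heven : Even ((d - 1) * d ^ (d - 2)) := (hodd.tsub_odd odd_one).mul_right _
    rw [sign_cnot1_of_odd hodd, one_pow, heven.neg_one_pow]
    exact ⟨rfl, iff_of_false (by decide) hne⟩
end

section
/- Let d be a prime. Consider the cyclic-shift permutation ρ of the set (Fin d → ZMod d) of basis labels of d qudits, defined by (ρ f)(i) = f(i − 1) (indices in Fin d taken cyclically), which cycles the states of the d qudit registers. The fixed points of ρ are exactly the constant functions, of which there are d, and the cycle type of ρ is the multiset consisting of the value d repeated d^(d−1) − 1 times, i.e. ρ has (d^d − d)/d cycles of length d. -/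
/-- The cyclic-shift permutation of the basis labels `Fin d → ZMod d` of a register of
`d` qudits of dimension `d`: it sends `f` to `i ↦ f (i - 1)`, indices taken cyclically. -/
def cyclicShift (d : ℕ) [NeZero d] : Equiv.Perm (Fin d → ZMod d) where
  toFun f := fun i => f (i - 1)
  invFun f := fun i => f (i + 1)
  left_inv f := by funext i; simp
  right_inv f := by funext i; simp

theorem cyclicShift_pow_apply (d : ℕ) [NeZero d] (n : ℕ) (f : Fin d → ZMod d) (i : Fin d) :
    (cyclicShift d ^ n) f i = f (i - n • 1) := by
  induction n generalizing i with
  | zero => simp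
  | succ n ih =>
    rw [pow_succ', Equiv.Perm.mul_apply]
    change (cyclicShift d ^ n) f (i - 1) = _
    rw [ih, succ_nsmul', sub_sub]

theorem cyclicShift_pow_self (d : ℕ) [NeZero d] : cyclicShift d ^ d = 1 := by
  ext1 f
  funext i
  have h : d • (1 : Fin d) = 0 := by
    simpa using card_nsmul_eq_zero' (x := (1 : Fin d))
  rw [cyclicShift_pow_apply, h, sub_zero, Equiv.Perm.one_apply]

open Fin.CommRing in
theorem cyclicShift_eq_self_iff (d : ℕ) [NeZero d] (f : Fin d → ZMod d) :
    cyclicShift d f = f ↔ ∃ c : ZMod d, f = Function.const (Fin d) c := by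
  refine ⟨fun h => ⟨f 0, funext fun i => ?_⟩, ?_⟩
  · have hi : i - i.val • 1 = 0 := by
      rw [nsmul_one, Fin.cast_val_eq_self, sub_self]
    have hf := congrFun (Equiv.Perm.pow_apply_eq_self_of_apply_eq_self h i.val) i
    rw [cyclicShift_pow_apply, hi] at hf
    exact hf.symm
  · rintro ⟨c, rfl⟩
    rfl

theorem card_fixedPoints_cyclicShift (d : ℕ) [NeZero d] :
    Nat.card {f : Fin d → ZMod d | cyclicShift d f = f} = d := by
  have h : {f : Fin d → ZMod d | cyclicShift d f = f} =
      Set.range (Function.const (Fin d) : ZMod d → Fin d → ZMod d) :=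
    Set.ext fun f => (cyclicShift_eq_self_iff d f).trans (exists_congr fun _ => eq_comm)
  rw [h, Nat.card_range_of_injective Function.const_injective, Nat.card_zmod]

theorem card_support_cyclicShift (d : ℕ) [NeZero d] :
    (cyclicShift d).support.card = d ^ d - d := by
  have h := Equiv.Perm.card_fixedPoints (cyclicShift d)
  have hfix : Fintype.card (Function.fixedPoints (cyclicShift d)) = d := by
    rw [← Nat.card_eq_fintype_card]
    exact card_fixedPoints_cyclicShift d
  have hle := (cyclicShift d).support.card_le_univ
  rw [hfix, Equiv.Perm.sum_cycleType] at h
  simp only [Fintype.card_fun, Fintype.card_fin, ZMod.card] at h hle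
  omega

theorem cyclicShift_fixedPoints_and_cycleType (d : ℕ) [Fact d.Prime] :
    {f : Fin d → ZMod d | cyclicShift d f = f} =
        {f : Fin d → ZMod d | ∃ c : ZMod d, f = Function.const (Fin d) c} ∧
    Nat.card {f : Fin d → ZMod d | cyclicShift d f = f} = d ∧
    (cyclicShift d).cycleType = Multiset.replicate (d ^ (d - 1) - 1) d := by
  refine ⟨Set.ext (cyclicShift_eq_self_iff d), card_fixedPoints_cyclicShift d, ?_⟩
  have hd : 0 < d := (Fact.out : d.Prime).pos
  have hrep := Equiv.Perm.cycleType_of_pow_prime_eq_one (cyclicShift_pow_self d)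
  have hsum := (cyclicShift d).sum_cycleType
  rw [hrep, Multiset.sum_replicate, card_support_cyclicShift, smul_eq_mul] at hsum
  rw [hrep]
  congr 1
  apply Nat.eq_of_mul_eq_mul_right hd
  rw [hsum, Nat.sub_mul, one_mul, pow_sub_one_mul hd.ne']
end
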